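/- arXiv:2002.04183 — 2 statements merged into one kernel-verified Lean document; each statement's English description precedes it below -/
import Mathlib

section
/- Let G be a finite group, k an algebraically closed field of characteristic r, V a kG-module, and H ≤ G a subgroup with O_{r'}(H) = O^r(H). Let P = Ind_H^G k be the permutation module on cosets of H. If V^H = 0, then H^n(G, V) ≅ Ext_G^{n-1}(V*, P/P^G) for all n ≥ 1. -/
/-- `OrEqOr r H` says that the largest normal subgroup of `H` of order not divisible
by `r` coincides with the smallest normal subgroup of `H` with `r`-group quotient
(i.e. `O_{r'}(H) = O^r(H)`), where for finite `H` the quotient `H ⧸ N` being an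
`r`-group is expressed by the index of `N` being a power of `r`. -/
def OrEqOr (r : ℕ) (H : Type) [Group H] : Prop :=
  ∃ A : Subgroup H, A.Normal ∧ (¬ r ∣ Nat.card A) ∧
    (∀ N : Subgroup H, N.Normal → ¬ r ∣ Nat.card N → N ≤ A) ∧
    (∃ m : ℕ, A.index = r ^ m) ∧
    (∀ N : Subgroup H, N.Normal → (∃ m : ℕ, N.index = r ^ m) → A ≤ N)

/-- The quotient representation on `V ⧸ W` for a `G`-invariant subspace `W`. -/
noncomputable def Representation.quot {k G V : Type} [Field k] [Group G] [AddCommGroup V]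
    [Module k V] (ρ : Representation k G V) (W : Submodule k V)
    (hW : ∀ g : G, W ≤ W.comap (ρ g)) : Representation k G (V ⧸ W) where
  toFun g := W.mapQ W (ρ g) (hW g)
  map_one' := by
    apply Submodule.linearMap_qext; ext v; simp [Submodule.mapQ_apply]
  map_mul' g h := by
    apply Submodule.linearMap_qext; ext v; simp [Submodule.mapQ_apply]

/-- The permutation module `P = Ind_H^G k` on the cosets of `H`, as a representation. -/
noncomputable def permRep (k G : Type) [Field k] [Group G] (H : Subgroup G) : Rep k G :=
  Rep.ofMulAction k G (G ⧸ H)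

/-- The quotient `P / P^G` of the permutation module on cosets of `H` by its
`G`-fixed submodule. -/
noncomputable def permQuot (k G : Type) [Field k] [Group G] (H : Subgroup G) : Rep k G :=
  Rep.of ((Representation.ofMulAction k G (G ⧸ H)).quot
    (Representation.invariants (Representation.ofMulAction k G (G ⧸ H)))
    (fun g v hv => by
      rw [Submodule.mem_comap,
        (Representation.mem_invariants (Representation.ofMulAction k G (G ⧸ H)) v).mp hv g]
      exact hv))

open CategoryTheory

section

open Limits MonoidalCategory

/-- A finite `p`-group acting linearly on a nonzero vector space that is also a `ZMod p`-module
fixes a nonzero vector. -/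
theorem IsPGroup.exists_ne_zero_mem_invariants_of_zmod_module {p : ℕ} [Fact p.Prime]
    {k Q V : Type*} [Field k] [Group Q] [Finite Q] (hQ : IsPGroup p Q) [AddCommGroup V]
    [Module k V] [Module (ZMod p) V] [Nontrivial V] (ρ : Representation k Q V) :
    ∃ v ∈ ρ.invariants, v ≠ 0 := by
  obtain ⟨w, hw⟩ := exists_ne (0 : V)
  let M : Submodule (ZMod p) V := Submodule.span (ZMod p) (Set.range fun q : Q => ρ q w)
  have hM : ∀ (q : Q) (x : V), x ∈ M → ρ q x ∈ M := by
    intro q x hx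
    induction hx using Submodule.span_induction with
    | mem x h =>
      obtain ⟨q', rfl⟩ := h
      exact Submodule.subset_span ⟨q * q', by simp⟩
    | zero => simp
    | add x y _ _ hx hy => rw [map_add]; exact add_mem hx hy
    | smul a x _ hx =>
      have := (AddMonoidHom.toZModLinearMap p ((ρ q).toAddMonoidHom)).map_smul a x
      exact this ▸ M.smul_mem a hx
  let : MulAction Q M :=
    { smul := fun q x => ⟨ρ q x, hM q x x.2⟩
      one_smul := fun x => Subtype.ext (by change ρ 1 x = _; simp)
      mul_smul := fun a b x => Subtype.ext (by change ρ (a * b) x = ρ a (ρ b x); simp) }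
  have hfin : Module.Finite (ZMod p) M := Module.Finite.span_of_finite _ (Set.finite_range _)
  have : Finite M := Module.finite_of_finite (ZMod p)
  have hMw : (⟨w, Submodule.subset_span ⟨1, by simp⟩⟩ : M) ≠ 0 := fun h =>
    hw (congrArg Subtype.val h)
  have : Nontrivial M := ⟨_, _, hMw⟩
  have hdvd : p ∣ Nat.card M := by
    rw [Module.natCard_eq_pow_finrank (K := ZMod p), Nat.card_zmod]
    exact dvd_pow_self _ Module.finrank_pos.ne'
  obtain ⟨b, hb, hb0⟩ := hQ.exists_fixed_point_of_prime_dvd_card_of_fixed_point M hdvd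
    (a := 0) (fun q => Subtype.ext (map_zero (ρ q)))
  exact ⟨(b : V), fun q => congrArg Subtype.val (hb q), fun h => hb0 (Subtype.ext h.symm)⟩

/-- A finite `p`-group acting linearly on a nonzero vector space in characteristic `p` fixes a
nonzero vector. -/
theorem IsPGroup.exists_ne_zero_mem_invariants {p : ℕ} [Fact p.Prime] {k Q V : Type*} [Field k]
    [CharP k p] [Group Q] [Finite Q] (hQ : IsPGroup p Q) [AddCommGroup V] [Module k V]
    [Nontrivial V] (ρ : Representation k Q V) : ∃ v ∈ ρ.invariants, v ≠ 0 :=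
  let : Module (ZMod p) V := AddCommGroup.zmodModule (n := p) fun x => by
    rw [← Nat.cast_smul_eq_nsmul k, CharP.cast_eq_zero, zero_smul]
  hQ.exists_ne_zero_mem_invariants_of_zmod_module ρ

/-- In characteristic `p`, a normal subgroup of `p`-power index has no nonzero invariants if the
whole group has none. -/
theorem Representation.invariants_comp_subtype_eq_bot {p m : ℕ} [Fact p.Prime] {k G V : Type*}
    [Field k] [CharP k p] [Group G] [AddCommGroup V] [Module k V] (ρ : Representation k G V)
    (N : Subgroup G) [N.Normal] (hN : N.index = p ^ m) (h : ρ.invariants = ⊥) :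
    invariants (ρ.comp N.subtype) = ⊥ := by
  by_contra hne
  have := (Submodule.nontrivial_iff_ne_bot).2 hne
  have hcard : Nat.card (G ⧸ N) = p ^ m := hN
  have : Finite (G ⧸ N) := Nat.finite_of_card_ne_zero
    (hcard ▸ pow_ne_zero _ (Fact.out : p.Prime).ne_zero)
  obtain ⟨v, hv, hv0⟩ := (IsPGroup.of_card hcard).exists_ne_zero_mem_invariants
    (ρ.quotientToInvariants N)
  have : (v : V) ∈ ρ.invariants := fun g => congrArg Subtype.val (hv (g : G ⧸ N))
  rw [h] at this
  exact hv0 (Subtype.ext this)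

theorem Representation.averageMap_apply {k G V : Type*} [CommRing k] [Group G] [Fintype G]
    [Invertible (Fintype.card G : k)] [AddCommGroup V] [Module k V] (ρ : Representation k G V)
    (v : V) : ρ.averageMap v = ⅟(Fintype.card G : k) • ∑ g, ρ g v := by
  simp [averageMap, GroupAlgebra.average]

namespace Rep

variable {k G : Type*} [CommRing k] [Group G] (N : Subgroup G) [N.Normal] [Fintype N]
  [Invertible (Fintype.card N : k)]

/-- Averaging over a normal subgroup, as an endomorphism of a representation. -/
noncomputable def normalAverage (A : Rep k G) : A ⟶ A :=
  Rep.ofHom ⟨Representation.averageMap (A.ρ.comp N.subtype), fun g => by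
    ext x
    simp only [LinearMap.comp_apply, Representation.averageMap_apply, map_smul, map_sum]
    congr 1
    refine Fintype.sum_equiv (MulAut.conjNormal g⁻¹ : N ≃* N).toEquiv _ _ fun n => ?_
    simp [← Module.End.mul_apply, ← map_mul, mul_assoc]⟩

theorem normalAverage_apply {A : Rep k G} (x : A) : (A.normalAverage N).hom x =
    ⅟(Fintype.card N : k) • ∑ n : N, A.ρ n x :=
  Representation.averageMap_apply (A.ρ.comp N.subtype) x

theorem normalAverage_comm {A B : Rep k G} (f : A ⟶ B) :
    f ≫ B.normalAverage N = A.normalAverage N ≫ f := by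
  ext x
  change (B.normalAverage N).hom (f.hom x) = f.hom ((A.normalAverage N).hom x)
  simp [normalAverage_apply, Rep.hom_comm_apply]

theorem normalAverage_eq_zero {A : Rep k G}
    (h : Representation.invariants (A.ρ.comp N.subtype) = ⊥) : A.normalAverage N = 0 := by
  ext x
  exact (Submodule.mem_bot k).1 (h ▸ Representation.averageMap_invariant (A.ρ.comp N.subtype) x)

theorem normalAverage_eq_id {A : Rep k G} [A.IsTrivial] : A.normalAverage N = 𝟙 A := by
  ext x
  exact Representation.averageMap_id (A.ρ.comp N.subtype) x fun n => by simp

end Rep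

open Rep in
/-- If a finite normal subgroup of order invertible in `k` has no nonzero invariants in `A`, then
the cohomology of `A` vanishes. -/
theorem groupCohomology.isZero_of_invariants_eq_bot {k G : Type} [Field k] [Group G]
    (N : Subgroup G) [N.Normal] [Finite N] (hN : (Nat.card N : k) ≠ 0) (A : Rep k G)
    (h : Representation.invariants (A.ρ.comp N.subtype) = ⊥) (n : ℕ) :
    IsZero (groupCohomology A n) := by
  have := Fintype.ofFinite N
  rw [Nat.card_eq_fintype_card] at hN
  let := invertibleOfNonzero hN
  refine IsZero.of_iso ?_ (groupCohomologyIsoExt A n)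
  let F := ((linearYoneda k (Rep k G)).obj A).rightOp
  suffices IsZero ((F.leftDerived n).obj (trivial k G k)) from this.unop
  let P := barResolution k G
  let e : P.complex ⟶ P.complex :=
    { f := fun i => normalAverage N (P.complex.X i)
      comm' := fun i j _ => (normalAverage_comm N _).symm }
  have he : e ≫ P.π = P.π ≫ (ChainComplex.single₀ (Rep k G)).map (𝟙 _) := by
    ext1
    simp only [CategoryTheory.Functor.map_id, Category.comp_id]
    change (P.complex.X 0).normalAverage N ≫ P.π.f 0 = P.π.f 0
    rw [← normalAverage_comm]
    have : ((((ChainComplex.single₀ (Rep k G)).obj (trivial k G k)).X 0)).normalAverage N = 𝟙 _ :=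
      normalAverage_eq_id (A := trivial k G k) N
    exact (congrArg (P.π.f 0 ≫ ·) this).trans (Category.comp_id _)
  have hF : (F.mapHomologicalComplex (ComplexShape.down ℕ)).map e = 0 := by
    ext i : 1
    apply Quiver.Hom.unop_inj
    ext (x : P.complex.X i ⟶ A)
    change (P.complex.X i).normalAverage N ≫ x = 0
    rw [← normalAverage_comm, normalAverage_eq_zero N h, comp_zero]
  rw [IsZero.iff_id_eq_zero, ← CategoryTheory.Functor.map_id,
    F.leftDerived_map_eq n (𝟙 _) e he, Functor.comp_map, hF, Functor.map_zero,
    zero_comp, comp_zero]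

namespace Rep

variable {k G : Type} [Field k] [Group G] (W : Rep k G)

instance : (ihom W).PreservesEpimorphisms where
  preserves {X Y} f hf := by
    rw [Rep.epi_iff_surjective] at hf ⊢
    intro φ
    obtain ⟨ψ, hψ⟩ := Module.projective_lifting_property f.hom.toLinearMap (φ : W →ₗ[k] Y) hf
    exact ⟨ψ, hψ⟩

instance : (tensorLeft W).PreservesMonomorphisms where
  preserves {X Y} f hf := by
    rw [Rep.mono_iff_injective] at hf ⊢
    exact Module.Flat.lTensor_preserves_injective_linearMap (M := W.V) f.hom.toLinearMap hf

instance : (tensorLeft W).PreservesProjectiveObjects where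
  projective_obj h := (ihom.adjunction W).map_projective _ h

instance : (tensorLeft W).PreservesHomology := by
  have := (ihom.adjunction W).leftAdjoint_preservesColimits
  have h : PreservesFiniteColimits (tensorLeft W) := inferInstance
  have := ((Functor.preservesFiniteColimits_tfae (tensorLeft W)).out 3 0).1 h
  apply ((Functor.exact_tfae (tensorLeft W)).out 0 2).1
  intro S hS
  have hm : Mono ((tensorLeft W).map S.f) := have := hS.mono_f; inferInstance
  exact { exact := (this S hS).1, mono_f := hm, epi_g := (this S hS).2 }

/-- The tensor-hom adjunction, as an isomorphism between the complexes of morphisms `W ⊗ P ⟶ Y`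
and `P ⟶ Hom(W, Y)` for a projective resolution `P`. -/
noncomputable def linearYonedaObjTensorIso {X : Rep k G} (P : ProjectiveResolution X)
    (Y : Rep k G) :
    ((tensorLeft W).mapProjectiveResolution P).complex.linearYonedaObj k Y ≅
      P.complex.linearYonedaObj k ((ihom W).obj Y) :=
  HomologicalComplex.Hom.isoOfComponents
    (fun _ ↦ (MonoidalClosed.linearHomEquiv _ _ _).toModuleIso) fun i j _ ↦
      ModuleCat.hom_ext (LinearMap.ext fun f =>
        ((ihom.adjunction W).homEquiv_naturality_left (P.complex.d j i) f).symm)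

/-- `Extⁿ(W, Y)` is the group cohomology of `Hom(W, Y)`. -/
noncomputable def extIsoGroupCohomologyIhom (Y : Rep k G) (n : ℕ) :
    ((Ext k (Rep k G) n).obj (Opposite.op W)).obj Y ≅ groupCohomology ((ihom W).obj Y) n :=
  ((Ext k (Rep k G) n).mapIso (ρ_ W).op).app Y ≪≫
  ((tensorLeft W).mapProjectiveResolution (barResolution k G)).isoExt n Y ≪≫
    (HomologicalComplex.homologyFunctor _ _ n).mapIso
      (linearYonedaObjTensorIso W (barResolution k G) Y) ≪≫
      (groupCohomologyIso _ n (barResolution k G)).symm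

end Rep

namespace Representation

variable {k G W : Type*} [Field k] [Group G] [AddCommGroup W] [Module k W]

theorem mem_invariants_ofMulAction_iff {X : Type*} [MulAction G X] [MulAction.IsPretransitive G X]
    (f : MonoidAlgebra k X) :
    f ∈ (ofMulAction k G X).invariants ↔ ∀ x y, f.coeff x = f.coeff y := by
  refine ⟨fun hf x y => ?_, fun hf g => ?_⟩
  · obtain ⟨g, rfl⟩ := MulAction.exists_smul_eq G x y
    conv_rhs => rw [← hf g]
    simp
  · ext x
    simpa using hf _ _

theorem mkQ_invariants_ofMulAction_comp_eq_zero_iff {X : Type*} [MulAction G X]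
    [MulAction.IsPretransitive G X] (φ : W →ₗ[k] MonoidAlgebra k X) :
    (ofMulAction k G X).invariants.mkQ ∘ₗ φ = 0 ↔
      ∀ w x y, (φ w).coeff x = (φ w).coeff y := by
  simp only [← mem_invariants_ofMulAction_iff (G := G), LinearMap.ext_iff]
  exact forall_congr' fun w => Submodule.Quotient.mk_eq_zero _

theorem invariants_dual_dual_eq_bot [FiniteDimensional k W] (ρ : Representation k G W)
    (h : ρ.invariants = ⊥) :
    ρ.dual.dual.invariants = ⊥ := by
  refine (Submodule.eq_bot_iff _).2 fun η hη => ?_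
  obtain ⟨v, rfl⟩ := (Module.evalEquiv k W).surjective η
  suffices v ∈ ρ.invariants by
    rw [h] at this
    rw [(Submodule.mem_bot k).1 this, map_zero]
  refine fun g => (Module.evalEquiv k W).injective ?_
  rw [← hη g]
  ext l
  simp [Module.Dual.transpose_apply]

/-- The map sending `φ : W → k[G ⧸ H]` to the `H`-equivariant function `G → W*` whose value at `x`
is the coefficient of `x φ x⁻¹` at the trivial coset. -/
noncomputable def linHomCosetsToCoind (ρ : Representation k G W) (H : Subgroup G) :
    (W →ₗ[k] MonoidAlgebra k (G ⧸ H)) →ₗ[k]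
      coindV H.subtype (MonoidHom.comp ρ.dual H.subtype) where
  toFun φ := ⟨fun x => Finsupp.lapply ((x⁻¹ : G) : G ⧸ H) ∘ₗ
    (MonoidAlgebra.coeffLinearEquiv k).toLinearMap ∘ₗ φ ∘ₗ ρ x⁻¹, fun h x => by
      have : ((x⁻¹ * (h : G)⁻¹ : G) : G ⧸ H) = ((x⁻¹ : G) : G ⧸ H) := by
        rw [QuotientGroup.eq]; simp
      ext w
      simp [this, dual_apply, Module.Dual.transpose_apply]⟩
  map_add' φ ψ := by ext; simp
  map_smul' c φ := by ext; simp

@[simp]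
theorem linHomCosetsToCoind_apply (ρ : Representation k G W) (H : Subgroup G)
    (φ : W →ₗ[k] MonoidAlgebra k (G ⧸ H)) (x : G) (w : W) :
    (linHomCosetsToCoind ρ H φ).1 x w = (φ (ρ x⁻¹ w)).coeff ((x⁻¹ : G) : G ⧸ H) := rfl

theorem linHomCosetsToCoind_bijective (ρ : Representation k G W) (H : Subgroup G)
    [Finite (G ⧸ H)] : Function.Bijective (linHomCosetsToCoind ρ H) := by
  refine ⟨(injective_iff_map_eq_zero _).2 fun φ hφ => ?_, fun f => ?_⟩
  · ext w c
    obtain ⟨x, rfl⟩ := QuotientGroup.mk_surjective c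
    have := LinearMap.congr_fun (congrFun (congrArg Subtype.val hφ) x⁻¹) (ρ x⁻¹ w)
    simpa using this
  · refine ⟨(MonoidAlgebra.coeffLinearEquiv k).symm.toLinearMap ∘ₗ
      (Finsupp.linearEquivFunOnFinite k k (G ⧸ H)).symm.toLinearMap ∘ₗ
      LinearMap.pi fun c => f.1 c.out⁻¹ ∘ₗ ρ c.out⁻¹, ?_⟩
    ext x w
    obtain ⟨h, hh⟩ := QuotientGroup.mk_out_eq_mul H x⁻¹
    have := f.2 h⁻¹ x
    simp only [Subgroup.subtype_apply, InvMemClass.coe_inv] at this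
    simp [hh, this, dual_apply, Module.Dual.transpose_apply]

/-- `Hom(W, k[G ⧸ H])` is coinduced from the restriction to `H` of the dual of `W`. -/
noncomputable def linHomCosetsEquivCoind (ρ : Representation k G W) (H : Subgroup G)
    [Finite (G ⧸ H)] :
    (linHom ρ (ofMulAction k G (G ⧸ H))).Equiv
      (coind H.subtype (MonoidHom.comp ρ.dual H.subtype)) :=
  .mk (LinearEquiv.ofBijective _ (linHomCosetsToCoind_bijective ρ H)) fun g => by
    ext φ x w
    change (linHomCosetsToCoind ρ H (linHom ρ _ g φ)).1 x w =
      (linHomCosetsToCoind ρ H φ).1 (x * g) w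
    simp

end Representation

namespace Rep

variable (k : Type) {G : Type} [Field k] [Group G] (H : Subgroup G) [Finite (G ⧸ H)]

/-- The projection from the permutation module on cosets of `H` to `permQuot k G H`. -/
noncomputable def permQuotπ : Rep.ofMulAction k G (G ⧸ H) ⟶ permQuot k G H :=
  Rep.ofHom ⟨Submodule.mkQ _, fun _ => rfl⟩

instance : Epi (permQuotπ k H) := (Rep.epi_iff_surjective _).2 (Submodule.mkQ_surjective _)

variable {k}

/-- The map `V → Hom(V*, k[G ⧸ H])` sending `v` to `l ↦ ∑ c, l v • c`. -/
noncomputable def toLinHomDualPerm (V : Rep k G) :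
    V →ₗ[k] (Module.Dual k V →ₗ[k] MonoidAlgebra k (G ⧸ H)) :=
  (LinearMap.smulRightₗ (R := k) (M₂ := Module.Dual k V)).flip
    ((MonoidAlgebra.coeffLinearEquiv k).symm ((Finsupp.linearEquivFunOnFinite k k (G ⧸ H)).symm 1))
    ∘ₗ Module.Dual.eval k V

@[simp]
theorem coeff_toLinHomDualPerm_apply (V : Rep k G) (v : V) (l : Module.Dual k V) (c : G ⧸ H) :
    (toLinHomDualPerm H V v l).coeff c = l v := by
  simp [toLinHomDualPerm]

/-- `toLinHomDualPerm` as a morphism of representations. -/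
noncomputable def toIhomDualPerm (V : Rep k G) :
    V ⟶ (ihom (Rep.of V.ρ.dual)).obj (Rep.ofMulAction k G (G ⧸ H)) :=
  Rep.ofHom ⟨toLinHomDualPerm H V, fun g => by
    ext v l c
    simp [Module.Dual.transpose_apply]⟩

/-- The sequence `V ⟶ Hom(V*, P) ⟶ Hom(V*, P / P^G)` where `P` is the permutation module on
cosets of `H`. -/
noncomputable def ihomDualPermSequence (V : Rep k G) : ShortComplex (Rep k G) where
  f := toIhomDualPerm H V
  g := (ihom (Rep.of V.ρ.dual)).map (permQuotπ k H)
  zero := by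
    ext v
    exact (Representation.mkQ_invariants_ofMulAction_comp_eq_zero_iff (G := G)
      (toLinHomDualPerm H V v)).2 fun l x y =>
      (coeff_toLinHomDualPerm_apply H V v l x).trans (coeff_toLinHomDualPerm_apply H V v l y).symm

theorem ihomDualPermSequence_shortExact (V : Rep k G) [FiniteDimensional k V] :
    (ihomDualPermSequence H V).ShortExact where
  exact := (forget₂ (Rep k G) (ModuleCat k)).reflects_exact_of_faithful _ <|
    (ShortComplex.moduleCat_exact_iff _).2 fun (φ : Module.Dual k V →ₗ[k] _) hφ => by
      have h := (Representation.mkQ_invariants_ofMulAction_comp_eq_zero_iff (G := G) φ).1 hφ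
      refine ⟨(Module.evalEquiv k V).symm (Finsupp.lapply ((1 : G) : G ⧸ H) ∘ₗ
        (MonoidAlgebra.coeffLinearEquiv k).toLinearMap ∘ₗ φ), ?_⟩
      change toLinHomDualPerm H V _ = φ
      ext l c
      simpa using h l _ _
  mono_f := (Rep.mono_iff_injective _).2 <| (injective_iff_map_eq_zero _).2 fun (v : V) hv => by
    refine (Module.forall_dual_apply_eq_zero_iff k v).1 fun l => ?_
    have : toLinHomDualPerm H V v = 0 := hv
    have h := coeff_toLinHomDualPerm_apply H V v l ((1 : G) : G ⧸ H)
    rw [this] at h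
    simpa using h.symm
  epi_g := inferInstanceAs (Epi ((ihom (Rep.of V.ρ.dual)).map (permQuotπ k H)))

/-- Shapiro's lemma for `Hom(V, k[G ⧸ H])`, in the form of a vanishing criterion. -/
theorem isZero_groupCohomology_ihom_perm
    (V : Rep k G) (n : ℕ)
    (h : IsZero (groupCohomology (Rep.of (MonoidHom.comp V.ρ.dual H.subtype)) n)) :
    IsZero (groupCohomology ((ihom V).obj (Rep.ofMulAction k G (G ⧸ H))) n) :=
  h.of_iso ((groupCohomology.functor k G n).mapIso
    (Rep.mkIso (Representation.linHomCosetsEquivCoind V.ρ H)) ≪≫ groupCohomology.coindIso _ n)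

end Rep

end

/-- Let `G` be a finite group, `k` an algebraically closed field of
characteristic `r`, `V` a `kG`-module, and `H ≤ G` with `O_{r'}(H) = O^r(H)`. Let
`P = Ind_H^G k` be the permutation module on cosets of `H`. If `V^H = 0`, then
`H^n(G, V) ≅ Ext_G^{n-1}(V*, P/P^G)` for all `n ≥ 1`. -/
theorem stmt2 {r : ℕ} [Fact r.Prime] {k G : Type} [Field k] [IsAlgClosed k] [CharP k r]
    [Group G] [Finite G] (H : Subgroup G) (hH : OrEqOr r H)
    (V : Rep k G) [FiniteDimensional k V]
    (hV : Representation.invariants (V.ρ.comp H.subtype) = ⊥) :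
    ∀ n : ℕ, 1 ≤ n →
      Nonempty (groupCohomology V n ≅
        ((Ext k (Rep k G) (n - 1)).obj (Opposite.op (Rep.of V.ρ.dual))).obj
          (permQuot k G H)) := by
  intro n hn
  obtain ⟨m, rfl⟩ := Nat.exists_eq_add_of_le' hn
  obtain ⟨A, _, hA, -, ⟨s, hs⟩, -⟩ := hH
  have hA0 : (Nat.card A : k) ≠ 0 := fun h => hA ((CharP.cast_eq_zero_iff k r _).1 h)
  have hVA : Representation.invariants ((V.ρ.comp H.subtype).comp A.subtype) = ⊥ :=
    Representation.invariants_comp_subtype_eq_bot _ A hs hV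
  have hz (i : ℕ) : Limits.IsZero (groupCohomology (Rep.ihomDualPermSequence H V).X₂ i) :=
    Rep.isZero_groupCohomology_ihom_perm H _ i <|
      groupCohomology.isZero_of_invariants_eq_bot A hA0 _
        (Representation.invariants_dual_dual_eq_bot _ hVA) i
  have hS := Rep.ihomDualPermSequence_shortExact H V
  have := groupCohomology.isIso_δ_of_isZero hS m (hz m) (hz (m + 1))
  exact ⟨(asIso (groupCohomology.δ hS m (m + 1) rfl)).symm ≪≫
    (Rep.extIsoGroupCohomologyIhom (Rep.of V.ρ.dual) (permQuot k G H) m).symm⟩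
end

section
/- Let G be a finite group, k an algebraically closed field of characteristic r, and V an irreducible kG-module that is the unique non-projective simple module in its block, and suppose the defect group of that block is cyclic. Then Ext_G^n(V, V) ≅ k for all n ≥ 0. -/
open CategoryTheory

/-- Relative trace map for the conjugation action on the group algebra: for a subgroup
`D ≤ G` and `x` in the group algebra, `conjTrace D x = ∑_{gD ∈ G/D} g x g⁻¹`. -/
noncomputable def conjTrace {k G : Type} [Field k] [Group G] [Finite G] (D : Subgroup G)
    (x : MonoidAlgebra k G) : MonoidAlgebra k G :=
  haveI : Fintype (G ⧸ D) := Fintype.ofFinite _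
  ∑ C : G ⧸ D,
    MonoidAlgebra.of k G (Quotient.out C) * x * MonoidAlgebra.of k G (Quotient.out C)⁻¹

/-- `D` is a defect group of the block idempotent `e`: `e` lies in the image of the
relative trace map `Tr_D^G` on `D`-fixed points of the group algebra, and `D` is minimal
with this property. -/
def IsDefectGroupOf {k G : Type} [Field k] [Group G] [Finite G] (D : Subgroup G)
    (e : MonoidAlgebra k G) : Prop :=
  (∃ x : MonoidAlgebra k G,
      (∀ d ∈ D, MonoidAlgebra.of k G d * x * MonoidAlgebra.of k G d⁻¹ = x) ∧
      conjTrace D x = e) ∧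
  ∀ D' : Subgroup G, D' ≤ D →
    (∃ x : MonoidAlgebra k G,
      (∀ d ∈ D', MonoidAlgebra.of k G d * x * MonoidAlgebra.of k G d⁻¹ = x) ∧
      conjTrace D' x = e) → D' = D

universe w u

section PeriodicResolution

variable {k : Type w} {C : Type u} [Field k] [Category.{w} C] [Abelian C] {P V : C}

/-- The complex `⋯ ⟶ P ⟶ P ⟶ P`, with differentials alternately `y` and `x` and augmentation
`p : P ⟶ V`, as a projective resolution of `V`. -/
noncomputable def periodicResolution [Projective P] (x y : P ⟶ P) (p : P ⟶ V) [Epi p]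
    (hxy : x ≫ y = 0) (hyx : y ≫ x = 0) (hxp : x ≫ p = 0)
    (exy : (ShortComplex.mk x y hxy).Exact) (eyx : (ShortComplex.mk y x hyx).Exact)
    (exp : (ShortComplex.mk x p hxp).Exact) : ProjectiveResolution V where
  complex := HomologicalComplex.alternatingConst P (φ := y) (ψ := x) hyx hxy
    fun _ _ => ComplexShape.down_nat_odd_add
  projective _ := inferInstanceAs <| Projective P
  π := (ChainComplex.toSingle₀Equiv _ _).symm ⟨p, by
    simpa [HomologicalComplex.alternatingConst] using! hxp⟩
  quasiIso := by
    constructor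
    intro m
    induction m with
    | zero =>
      rw [ChainComplex.quasiIsoAt₀_iff, ShortComplex.quasiIso_iff_of_zeros' _ rfl rfl rfl]
      constructor
      · refine (ShortComplex.exact_iff_of_iso ?_).1 exp
        refine ShortComplex.isoMk (Iso.refl _) (Iso.refl _) (Iso.refl _) ?_ ?_
        · simp only [HomologicalComplex.alternatingConst]
          exact (Category.id_comp _).trans (Category.comp_id _).symm
        · refine (Category.id_comp _).trans
            ((ChainComplex.toSingle₀Equiv_symm_apply_f_zero ..).trans (Category.comp_id _).symm)
      · rw [show ShortComplex.Hom.τ₂ _ = p from ChainComplex.toSingle₀Equiv_symm_apply_f_zero ..]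
        exact (inferInstance : Epi p)
    | succ m _ =>
      rw [quasiIsoAt_iff_exactAt' (hL := ChainComplex.exactAt_succ_single_obj ..)]
      rw [HomologicalComplex.exactAt_iff' _ (m + 2) (m + 1) m (by simp) (by simp)]
      rcases Nat.even_or_odd (m + 1) with h | h
      · exact (ShortComplex.exact_iff_of_iso (HomologicalComplex.alternatingConstScIsoEven
          P hyx hxy _ (by simp) (by simp) h)).2 exy
      · exact (ShortComplex.exact_iff_of_iso (HomologicalComplex.alternatingConstScIsoOdd
          P hyx hxy _ (by simp) (by simp) h)).2 eyx

theorem nonempty_ext_iso_of_periodic [Linear k C] [EnoughProjectives C] [Projective P]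
    [Simple V] (x y : P ⟶ P) (p : P ⟶ V) [Epi p]
    (hxy : x ≫ y = 0) (hyx : y ≫ x = 0) (hxp : x ≫ p = 0) (hyp : y ≫ p = 0)
    (exy : (ShortComplex.mk x y hxy).Exact) (eyx : (ShortComplex.mk y x hyx).Exact)
    (exp : (ShortComplex.mk x p hxp).Exact) (hp : ∀ f : P ⟶ V, ∃ c : k, c • p = f) (n : ℕ) :
    Nonempty (((Ext k C n).obj (Opposite.op V)).obj V ≅ ModuleCat.of k k) := by
  let R := periodicResolution x y p hxy hyx hxp exy eyx exp
  have hd : ∀ i j, (R.complex.linearYonedaObj k V).d i j = 0 := by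
    intro i j
    ext f
    obtain ⟨c, rfl⟩ := hp f
    change R.complex.d j i ≫ (c • p) = 0
    dsimp [R, periodicResolution, HomologicalComplex.alternatingConst]
    split_ifs
    · exact (Linear.comp_smul ..).trans (by rw [hyp]; exact smul_zero c)
    · exact (Linear.comp_smul ..).trans (by rw [hxp]; exact smul_zero c)
    · exact Limits.zero_comp
  have hp0 : p ≠ 0 := fun h => id_nonzero V <| by
    rw [← cancel_epi p, h, Limits.zero_comp, Limits.zero_comp]
  have e : k ≃ₗ[k] (P ⟶ V) := LinearEquiv.ofBijective (LinearMap.toSpanSingleton k _ p)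
    ⟨smul_left_injective k hp0, hp⟩
  exact ⟨R.isoExt n V ≪≫
    (ShortComplex.HomologyData.ofZeros _ (hd _ _) (hd _ _)).left.homologyIso ≪≫ e.symm.toModuleIso⟩

end PeriodicResolution

section ProjectiveCover

variable {A V : Type*} [Ring A] [AddCommGroup V] [Module A V]

theorem Module.Projective.of_isCompl {M : Type*} [AddCommGroup M] [Module A M]
    [Module.Projective A M] {p q : Submodule A M} (h : IsCompl p q) : Module.Projective A p :=
  .of_split p.subtype (p.projectionOnto q h) (by ext; simp)

/-- Every simple module over an Artinian ring has a projective cover inside the ring. -/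
theorem exists_projective_cover_of_isSimpleModule (A V : Type*) [Ring A] [AddCommGroup V]
    [Module A V] [IsArtinianRing A] [IsSimpleModule A V] :
    ∃ (P : Submodule A A) (π : P →ₗ[A] V), Module.Projective A P ∧ Function.Surjective π ∧
      ∀ N : Submodule A P, ¬ N ≤ LinearMap.ker π → N = ⊤ := by
  let S : Set (Submodule A A) :=
    {P | Module.Projective A P ∧ ∃ π : P →ₗ[A] V, Function.Surjective π}
  have hS : S.Nonempty := by
    obtain ⟨v, hv⟩ := @exists_ne V (IsSimpleModule.nontrivial A V) 0
    refine ⟨⊤, .of_equiv Submodule.topEquiv.symm,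
      LinearMap.toSpanSingleton A V v ∘ₗ Submodule.topEquiv.toLinearMap, ?_⟩
    exact (IsSimpleModule.toSpanSingleton_surjective A hv).comp Submodule.topEquiv.surjective
  obtain ⟨P, ⟨hP, π, hπ⟩, hmin⟩ := WellFounded.has_min (wellFounded_lt) S hS
  refine ⟨P, π, hP, hπ, fun N hN => ?_⟩
  have hNs : Function.Surjective (π ∘ₗ N.subtype) := by
    refine (LinearMap.surjective_or_eq_zero _).resolve_right fun h => hN fun x hx => ?_
    exact LinearMap.congr_fun h ⟨x, hx⟩
  obtain ⟨φ₀, hφ₀⟩ := Module.projective_lifting_property _ π hNs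
  set φ : Module.End A P := N.subtype ∘ₗ φ₀ with hφ
  have hπφ : ∀ n x, π ((φ ^ n) x) = π x := by
    intro n
    induction n with
    | zero => simp
    | succ n ih => intro x; rw [pow_succ, Module.End.mul_apply, ih]; exact LinearMap.congr_fun hφ₀ x
  obtain ⟨n, hn, hn1⟩ := (φ.eventually_isCompl_ker_pow_range_pow.and
    (Filter.eventually_ge_atTop 1)).exists
  have hR : Module.Projective A (LinearMap.range (φ ^ n)) := .of_isCompl hn.symm
  let Q := (LinearMap.range (φ ^ n)).map P.subtype
  let eQ : LinearMap.range (φ ^ n) ≃ₗ[A] Q :=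
    Submodule.equivMapOfInjective _ P.injective_subtype _
  have hQ : Q ∈ S := by
    refine ⟨.of_equiv eQ, π ∘ₗ Submodule.subtype _ ∘ₗ eQ.symm.toLinearMap, fun v => ?_⟩
    obtain ⟨x, rfl⟩ := hπ v
    exact ⟨eQ ⟨_, x, rfl⟩, by simp [hπφ]⟩
  have hQP : Q = P := by
    have hle : Q ≤ P := Submodule.map_subtype_le _ _
    exact hle.eq_of_not_lt (hmin Q hQ)
  rw [eq_top_iff]
  intro x _
  have hx : (x : A) ∈ Q := hQP.symm ▸ x.2
  obtain ⟨y, ⟨z, rfl⟩, hyx⟩ := hx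
  have hzx : (φ ^ n) z = x := Subtype.ext hyx
  obtain ⟨m, hm⟩ := Nat.exists_eq_add_of_le' hn1
  rw [← hzx, hm, pow_succ']
  exact (φ₀ ((φ ^ m) z)).2

end ProjectiveCover

section LocalProjective

variable {k A V P : Type*} [Field k] [Ring A] [Algebra k A] [AddCommGroup V] [Module k V]
  [Module A V] [IsScalarTower k A V] [AddCommGroup P] [Module k P] [Module A P]
  [IsScalarTower k A P] [IsSimpleModule A V] {π : P →ₗ[A] V}

omit [Module k P] [IsScalarTower k A P] [IsSimpleModule A V] in
theorem exists_smul_eq_of_ker_le (hV : ∀ f : V →ₗ[A] V, ∃ c : k, f = c • LinearMap.id)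
    {f g : P →ₗ[A] V} (hf : Function.Surjective f) (h : LinearMap.ker f ≤ LinearMap.ker g) :
    ∃ c : k, g = c • f := by
  obtain ⟨c, hc⟩ := hV ((LinearMap.ker f).liftQ g h ∘ₗ
    (f.quotKerEquivOfSurjective hf).symm.toLinearMap)
  refine ⟨c, LinearMap.ext fun x => ?_⟩
  have := LinearMap.congr_fun hc (f x)
  rwa [LinearMap.comp_apply, LinearEquiv.coe_coe, ← f.quotKerEquivOfSurjective_apply_mk hf,
    LinearEquiv.symm_apply_apply, Submodule.liftQ_apply] at this

omit [Module k P] [IsScalarTower k A P] in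
theorem exists_smul_eq_of_local (hV : ∀ f : V →ₗ[A] V, ∃ c : k, f = c • LinearMap.id)
    (hπ : Function.Surjective π) (hloc : ∀ N : Submodule A P, ¬ N ≤ LinearMap.ker π → N = ⊤)
    (f : P →ₗ[A] V) : ∃ c : k, f = c • π := by
  refine exists_smul_eq_of_ker_le hV hπ ?_
  by_contra hk
  have hs : Function.Surjective (f ∘ₗ (LinearMap.ker π).subtype) := by
    refine (LinearMap.surjective_or_eq_zero _).resolve_right fun h => hk fun x hx => ?_
    exact LinearMap.congr_fun h ⟨x, hx⟩
  have hf : LinearMap.ker f = ⊤ := by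
    refine hloc _ fun hle => ?_
    obtain ⟨v, hv⟩ := @exists_ne V (IsSimpleModule.nontrivial A V) 0
    obtain ⟨x, rfl⟩ := hπ v
    obtain ⟨u, hu⟩ := hs (f x)
    have : x - u ∈ LinearMap.ker π := hle (by simpa [sub_eq_zero] using hu.symm)
    apply hv
    rw [← sub_add_cancel x u, map_add, LinearMap.mem_ker.1 this, LinearMap.mem_ker.1 u.2, add_zero]
  exact hk (hf ▸ le_top)

/-- Two independent maps `a, b` from the radical `ker π` of `P` to `V` give a family
`P ⧸ ker (a + s • b)` of modules of length two, such that every map between two different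
members kills the socle. -/
theorem exists_family_of_linearIndependent [Module.Projective A P]
    (hV : ∀ f : V →ₗ[A] V, ∃ c : k, f = c • LinearMap.id)
    (hπ : Function.Surjective π) (hloc : ∀ N : Submodule A P, ¬ N ≤ LinearMap.ker π → N = ⊤)
    {a b : LinearMap.ker π →ₗ[A] V} (hab : LinearIndependent k ![a, b]) :
    ∃ L : k → Submodule A P, ∀ s, ∃ v : P ⧸ L s, v ≠ 0 ∧
      ∀ t, s ≠ t → ∀ f : (P ⧸ L s) →ₗ[A] (P ⧸ L t), f v = 0 := by
  rw [LinearIndependent.pair_iff] at hab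
  have hne : ∀ s : k, a + s • b ≠ 0 := fun s h =>
    one_ne_zero (hab 1 s (by rwa [one_smul])).1
  let L : k → Submodule A P := fun s => (LinearMap.ker (a + s • b)).map (LinearMap.ker π).subtype
  have hL : ∀ s (u : LinearMap.ker π), (u : P) ∈ L s ↔ (a + s • b) u = 0 := by
    intro s u
    simp [L]
  refine ⟨L, fun s => ?_⟩
  obtain ⟨u, hu⟩ : ∃ u, (a + s • b) u ≠ 0 := by
    by_contra! h
    exact hne s (LinearMap.ext h)
  refine ⟨(L s).mkQ u, ?_, fun t hst f => ?_⟩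
  · rw [Submodule.mkQ_apply, Ne, Submodule.Quotient.mk_eq_zero, hL]
    exact hu
  obtain ⟨φ, hφ⟩ := Module.projective_lifting_property (L t).mkQ (f ∘ₗ (L s).mkQ)
    (Submodule.mkQ_surjective _)
  replace hφ : ∀ x, (L t).mkQ (φ x) = f ((L s).mkQ x) := LinearMap.congr_fun hφ
  obtain ⟨c, hc⟩ := exists_smul_eq_of_local (k := k) hV hπ hloc (π ∘ₗ φ)
  replace hc : ∀ x, π (φ x) = c • π x := LinearMap.congr_fun hc
  have hπk : ∀ (c : k) (x : P), π (c • x) = c • π x := fun c x => LinearMap.map_smul_of_tower ..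
  let ψ : P →ₗ[A] LinearMap.ker π := (φ - c • LinearMap.id).codRestrict _ fun x => by
    simp [hc, hπk]
  have key : ∀ u : LinearMap.ker π, ∃ w : LinearMap.ker π, (w : P) = φ u ∧
      (a + t • b) w = c • (a + t • b) u := by
    intro u
    refine ⟨ψ u + c • u, by simp [ψ], ?_⟩
    obtain ⟨d, hd⟩ := exists_smul_eq_of_local (k := k) hV hπ hloc ((a + t • b) ∘ₗ ψ)
    have hd' : (a + t • b) (ψ u) = d • π u := LinearMap.congr_fun hd u
    rw [map_add, hd', LinearMap.mem_ker.1 u.2, smul_zero, zero_add]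
    exact LinearMap.map_smul_of_tower ..
  rcases eq_or_ne c 0 with rfl | hc0
  · obtain ⟨w, hw, hw'⟩ := key u
    rw [← hφ, Submodule.mkQ_apply, Submodule.Quotient.mk_eq_zero, ← hw, hL, hw', zero_smul]
  · exfalso
    have hle : LinearMap.ker (a + s • b) ≤ LinearMap.ker (a + t • b) := by
      intro u hu
      obtain ⟨w, hw, hw'⟩ := key u
      have h1 : (w : P) ∈ L t := by
        rw [← Submodule.Quotient.mk_eq_zero, ← Submodule.mkQ_apply, hw, hφ, Submodule.mkQ_apply,
          (Submodule.Quotient.mk_eq_zero _).2 ((hL s u).2 hu), map_zero]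
      rw [hL, hw'] at h1
      exact (smul_eq_zero.1 h1).resolve_left hc0
    obtain ⟨l, hl⟩ := exists_smul_eq_of_ker_le hV
      ((LinearMap.surjective_or_eq_zero _).resolve_right (hne s)) hle
    have h2 : (1 - l) • a + (t - l * s) • b = 0 := by
      rw [sub_smul, sub_smul, one_smul, mul_smul, ← sub_eq_zero.2 hl, smul_add]
      abel
    obtain ⟨h3, h4⟩ := hab _ _ h2
    obtain rfl : 1 = l := sub_eq_zero.1 h3
    exact hst (by rw [one_mul] at h4; exact (sub_eq_zero.1 h4).symm)

/-- A local projective module whose radical has at most one-dimensional head, all simple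
subquotients being isomorphic, is uniserial; its simple quotient has a periodic resolution. -/
theorem exists_periodic_of_local [FiniteDimensional k P] [Module.Finite A P]
    [Module.Projective A P] (hπ : Function.Surjective π)
    (hloc : ∀ N : Submodule A P, ¬ N ≤ LinearMap.ker π → N = ⊤)
    (hker : LinearMap.ker π ≠ ⊥)
    (hsimple : ∀ M : Submodule A (LinearMap.ker π), IsCoatom M →
      ∃ b : LinearMap.ker π →ₗ[A] V, LinearMap.ker b = M)
    (hdep : ∀ a b : LinearMap.ker π →ₗ[A] V, ¬ LinearIndependent k ![a, b]) :
    ∃ x y : P →ₗ[A] P, LinearMap.range x = LinearMap.ker π ∧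
      LinearMap.range x = LinearMap.ker y ∧ LinearMap.range y = LinearMap.ker x ∧
      π ∘ₗ y = 0 := by
  have : IsNoetherian A P := isNoetherian_of_tower k inferInstance
  have : IsArtinian A P := isArtinian_of_tower k inferInstance
  have : Nontrivial V := IsSimpleModule.nontrivial A V
  have hlt : ¬ (⊤ : Submodule A P) ≤ LinearMap.ker π := fun h => by
    obtain ⟨v, hv⟩ := exists_ne (0 : V)
    obtain ⟨x, rfl⟩ := hπ v
    exact hv (h trivial)
  have hbt : (⊥ : Submodule A (LinearMap.ker π)) ≠ ⊤ := fun h => hker <| by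
    rw [← Submodule.map_subtype_top (LinearMap.ker π), ← h, Submodule.map_bot]
  obtain ⟨M, hM, -⟩ := (eq_top_or_exists_le_coatom (⊥ : Submodule A (LinearMap.ker π))).resolve_left
    hbt
  obtain ⟨a, rfl⟩ := hsimple M hM
  have ha : Function.Surjective a := (LinearMap.surjective_or_eq_zero a).resolve_right fun h =>
    hM.1 (LinearMap.ker_eq_top.2 h)
  obtain ⟨x₀, hx₀⟩ := Module.projective_lifting_property a π ha
  have hx₀s : LinearMap.range x₀ = ⊤ := by
    refine (eq_top_or_exists_le_coatom _).resolve_right ?_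
    rintro ⟨M', hM', hle⟩
    obtain ⟨b, rfl⟩ := hsimple M' hM'
    apply hdep a b
    rw [LinearIndependent.pair_iff]
    intro s t hst
    have hs : s = 0 := by
      obtain ⟨v, hv⟩ := exists_ne (0 : V)
      obtain ⟨p, rfl⟩ := hπ v
      have h1 : s • a (x₀ p) + t • b (x₀ p) = 0 := LinearMap.congr_fun hst (x₀ p)
      have h2 : b (x₀ p) = 0 := hle ⟨p, rfl⟩
      have h3 : a (x₀ p) = π p := LinearMap.congr_fun hx₀ p
      rw [h2, smul_zero, add_zero, h3] at h1
      exact (smul_eq_zero.1 h1).resolve_right hv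
    refine ⟨hs, ?_⟩
    rw [hs, zero_smul, zero_add] at hst
    exact (smul_eq_zero.1 hst).resolve_right fun h => hM'.1 (LinearMap.ker_eq_top.2 h)
  set x : Module.End A P := (LinearMap.ker π).subtype ∘ₗ x₀
  have hx : LinearMap.range x = LinearMap.ker π := by
    rw [LinearMap.range_comp, hx₀s, Submodule.map_subtype_top]
  have hnil : ∃ n, x ^ n = 0 := by
    obtain ⟨n, hn, hn1⟩ := (x.eventually_isCompl_ker_pow_range_pow.and
      (Filter.eventually_ge_atTop 1)).exists
    refine ⟨n, LinearMap.ker_eq_top.1 <| hloc _ fun h => hlt ?_⟩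
    rw [← hn.sup_eq_top]
    refine sup_le h ?_
    obtain ⟨m, rfl⟩ := Nat.exists_eq_add_of_le' hn1
    rw [← hx, pow_succ']
    exact LinearMap.range_comp_le_range _ _
  have hPn : Nontrivial P := hπ.nontrivial
  classical
  obtain ⟨j, hj⟩ : ∃ j, Nat.find hnil = j + 1 := Nat.exists_eq_succ_of_ne_zero fun h => by
    have := Nat.find_spec hnil
    rw [h, pow_zero] at this
    exact one_ne_zero this
  have hj1 : x ^ (j + 1) = 0 := hj ▸ Nat.find_spec hnil
  have hj0 : x ^ j ≠ 0 := Nat.find_min hnil (by omega)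
  obtain ⟨i, rfl⟩ : ∃ i, j = i + 1 := Nat.exists_eq_succ_of_ne_zero fun h => hker <| by
    rw [← hx, LinearMap.range_eq_bot]
    simpa [h] using hj1
  have hy : LinearMap.range x = LinearMap.ker (x ^ (i + 1)) := by
    apply le_antisymm
    · rw [LinearMap.range_le_ker_iff, ← Module.End.mul_eq_comp, ← pow_succ, hj1]
    · rw [hx]
      by_contra h
      exact hj0 (LinearMap.ker_eq_top.1 (hloc _ h))
  refine ⟨x, x ^ (i + 1), hx, hy, ?_, ?_⟩
  · have hle : LinearMap.range (x ^ (i + 1)) ≤ LinearMap.ker x := by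
      rw [LinearMap.range_le_ker_iff, ← Module.End.mul_eq_comp, ← pow_succ', hj1]
    apply Submodule.restrictScalars_injective k
    apply Submodule.eq_of_le_of_finrank_eq hle
    have h1 := ((x ^ (i + 1)).restrictScalars k).finrank_range_add_finrank_ker
    have h2 := (x.restrictScalars k).finrank_range_add_finrank_ker
    rw [LinearMap.ker_restrictScalars, LinearMap.range_restrictScalars] at h1 h2
    rw [hy] at h2
    omega
  · rw [← LinearMap.range_le_ker_iff, ← hx, pow_succ']
    exact LinearMap.range_comp_le_range _ _

end LocalProjective

section FiniteType

open Polynomial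

theorem Polynomial.finite_quotient_of_mem {k : Type*} [Field k] {f : k[X]} (hf : f ≠ 0)
    {I : Ideal k[X]} (h : f ∈ I) : Module.Finite k (k[X] ⧸ I) := by
  have : Module.Finite k (k[X] ⧸ Ideal.span {f}) := (AdjoinRoot.powerBasis hf).finite
  have hI := (Ideal.span_singleton_le_iff_mem I).2 h
  exact .of_surjective (Ideal.Quotient.factorₐ k hI).toLinearMap
    (Ideal.Quotient.factor_surjective hI)

/-- The modules `k[X] ⧸ I` with `I ∣ (f)`, each repeated `n + 1` times. -/
abbrev TorsionSum {k : Type*} [Field k] (f : k[X]) (n : ℕ) : Type _ :=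
  (j : {I : Ideal k[X] // I ∣ Ideal.span {f}} × Fin (n + 1)) → k[X] ⧸ j.1.1

theorem TorsionSum.finiteDimensional {k : Type*} [Field k] {f : k[X]} (hf : f ≠ 0) (n : ℕ) :
    FiniteDimensional k (TorsionSum f n) := by
  have := UniqueFactorizationMonoid.fintypeSubtypeDvd (Ideal.span {f}) (by simpa using hf)
  have (j : {I : Ideal k[X] // I ∣ Ideal.span {f}} × Fin (n + 1)) :
      Module.Finite k (k[X] ⧸ j.1.1) :=
    Polynomial.finite_quotient_of_mem hf (Ideal.dvd_span_singleton.1 j.1.2)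
  infer_instance

/-- Every module of dimension at most `n` killed by `f` is a summand of `TorsionSum f n`. -/
theorem TorsionSum.exists_retract {k M : Type*} [Field k] [AddCommGroup M] [Module k M]
    [Module k[X] M] [IsScalarTower k k[X] M] [FiniteDimensional k M] {f : k[X]} (hf : f ≠ 0)
    (hM : ∀ m : M, f • m = 0) {n : ℕ} (hn : Module.finrank k M ≤ n) :
    ∃ (i : M →ₗ[k[X]] TorsionSum f n) (p : TorsionSum f n →ₗ[k[X]] M), p ∘ₗ i = LinearMap.id := by
  classical
  have hfin : Module.Finite k[X] M := .of_restrictScalars_finite k k[X] M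
  obtain ⟨ι, _, q, -, d, ⟨Φ⟩⟩ := Module.equiv_directSum_of_isTorsion (R := k[X]) (M := M)
    fun m => ⟨⟨f, mem_nonZeroDivisors_of_ne_zero hf⟩, hM m⟩
  let Ψ := Φ.trans (DirectSum.linearEquivFunOnFintype k[X] ι _)
  let J : ι → Ideal k[X] := fun i => k[X] ∙ q i ^ d i
  have hJf : ∀ i, f ∈ J i := by
    intro i
    rw [← Submodule.Quotient.mk_eq_zero]
    have h : f • (Pi.single i (Submodule.Quotient.mk 1) : (i : ι) → k[X] ⧸ J i) = 0 := by
      obtain ⟨m, hm⟩ := Ψ.surjective (Pi.single i (Submodule.Quotient.mk 1))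
      rw [← hm, ← map_smul, hM, map_zero]
    have := congr_fun h i
    rwa [Pi.smul_apply, Pi.single_eq_same, ← Submodule.Quotient.mk_smul, smul_eq_mul,
      mul_one] at this
  have (i : ι) : Module.Finite k (k[X] ⧸ J i) := Polynomial.finite_quotient_of_mem hf (hJf i)
  have hcard : Fintype.card {i // J i ≠ ⊤} ≤ n := by
    refine le_trans ?_ hn
    rw [(Ψ.restrictScalars k).finrank_eq, Module.finrank_pi_fintype, Fintype.card_subtype,
      Finset.card_eq_sum_ones]
    refine (Finset.sum_le_sum fun i hi => ?_).trans
      (Finset.sum_le_sum_of_subset (Finset.filter_subset _ _))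
    have : Nontrivial (k[X] ⧸ J i) := Ideal.Quotient.nontrivial_iff.2 (Finset.mem_filter.1 hi).2
    exact Module.finrank_pos
  obtain ⟨σ⟩ : Nonempty ({i // J i ≠ ⊤} ↪ Fin n) :=
    Function.Embedding.nonempty_of_card_le (by simpa using hcard)
  let j : ι → {I : Ideal k[X] // I ∣ Ideal.span {f}} × Fin (n + 1) := fun i =>
    (⟨J i, Ideal.dvd_span_singleton.2 (hJf i)⟩, if h : J i ≠ ⊤ then (σ ⟨i, h⟩).castSucc else 0)
  have hj : ∀ i i', J i ≠ ⊤ → J i' ≠ ⊤ → j i = j i' → i = i' := by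
    intro i i' hi hi' h
    have := congr_arg Prod.snd h
    simp only [j, dif_pos hi, dif_pos hi'] at this
    exact congr_arg Subtype.val (σ.injective (Fin.castSucc_injective n this))
  let p : TorsionSum f n →ₗ[k[X]] ((i : ι) → k[X] ⧸ J i) :=
    LinearMap.pi fun i => LinearMap.proj (j i)
  let s : ((i : ι) → k[X] ⧸ J i) →ₗ[k[X]] TorsionSum f n :=
    ∑ i with J i ≠ ⊤, (LinearMap.single k[X] (fun j : {I : Ideal k[X] // I ∣ Ideal.span {f}} ×
      Fin (n + 1) => k[X] ⧸ j.1.1) (j i)) ∘ₗ LinearMap.proj i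
  have hps : ∀ v, p (s v) = v := by
    intro v
    funext i
    by_cases hi : J i = ⊤
    · have : Subsingleton (k[X] ⧸ J i) := Ideal.Quotient.subsingleton_iff.2 hi
      exact Subsingleton.elim _ _
    · change s v (j i) = v i
      rw [LinearMap.sum_apply, Finset.sum_apply, Finset.sum_eq_single i]
      · exact Pi.single_eq_same _ _
      · intro i' hi' hne
        refine Pi.single_eq_of_ne (fun h => hne ?_) _
        exact hj _ _ (Finset.mem_filter.1 hi').2 hi h.symm
      · simp [hi]
  exact ⟨s ∘ₗ Ψ.toLinearMap, Ψ.symm.toLinearMap ∘ₗ p, LinearMap.ext fun m => by simp [hps]⟩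

end FiniteType

section RelativeTrace

open Polynomial

theorem TorsionSum.exists_retract_of_aeval {k M : Type*} [Field k] [AddCommGroup M] [Module k M]
    [FiniteDimensional k M] {f : k[X]} (hf : f ≠ 0) (T : Module.End k M) (hT : aeval T f = 0)
    {n : ℕ} (hn : Module.finrank k M ≤ n) :
    ∃ (i : M →ₗ[k] TorsionSum f n) (p : TorsionSum f n →ₗ[k] M),
      (∀ m, i (T m) = (X : k[X]) • i m) ∧ (∀ w, p ((X : k[X]) • w) = T (p w)) ∧
        ∀ m, p (i m) = m := by
  have : FiniteDimensional k (Module.AEval' T) := .equiv (Module.AEval'.of T)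
  obtain ⟨i, p, hip⟩ := TorsionSum.exists_retract (M := Module.AEval' T) hf
    (fun m => by
      obtain ⟨m, rfl⟩ := (Module.AEval'.of T).surjective m
      have := Module.AEval.of_aeval_smul (a := T) (f := f) (m := m)
      rw [hT] at this
      exact this.symm.trans (by simp))
    (n := n) (by rwa [← (Module.AEval'.of T).finrank_eq])
  refine ⟨i.restrictScalars k ∘ₗ (Module.AEval'.of T).toLinearMap,
    (Module.AEval'.of T).symm.toLinearMap ∘ₗ p.restrictScalars k, fun m => ?_, fun w => ?_,
    fun m => ?_⟩
  · simp [← Module.AEval'.X_smul_of]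
  · simp
  · have := LinearMap.congr_fun hip (Module.AEval'.of T m)
    simp at this
    simp [this]

variable {k G : Type*} [Field k] [Group G] {E F : Type*} [AddCommGroup E] [Module k E]
  [Module (MonoidAlgebra k G) E] [IsScalarTower k (MonoidAlgebra k G) E] [AddCommGroup F]
  [Module k F] [Module (MonoidAlgebra k G) F] [IsScalarTower k (MonoidAlgebra k G) F]

/-- The relative trace of a `D`-equivariant map is `G`-equivariant. -/
theorem exists_linearMap_eq_relTrace (D : Subgroup G) [Fintype (G ⧸ D)] (ψ : E →ₗ[k] F)
    (hψ : ∀ d ∈ D, ∀ v, ψ (MonoidAlgebra.of k G d • v) = MonoidAlgebra.of k G d • ψ v) :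
    ∃ φ : E →ₗ[MonoidAlgebra k G] F, ∀ v, φ v = ∑ C : G ⧸ D,
      MonoidAlgebra.of k G C.out • ψ (MonoidAlgebra.of k G C.out⁻¹ • v) := by
  let φ₀ : E →ₗ[k] F := ∑ C : G ⧸ D, Algebra.lsmul k k F (MonoidAlgebra.of k G C.out)
    ∘ₗ ψ ∘ₗ Algebra.lsmul k k E (MonoidAlgebra.of k G C.out⁻¹)
  have hφ₀ : ∀ v, φ₀ v = ∑ C : G ⧸ D,
      MonoidAlgebra.of k G C.out • ψ (MonoidAlgebra.of k G C.out⁻¹ • v) := fun v => by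
    simp [φ₀]
  refine ⟨MonoidAlgebra.equivariantOfLinearOfComm φ₀ fun g v => ?_, hφ₀⟩
  rw [← MonoidAlgebra.of_apply, hφ₀, hφ₀]
  let c : G → F := fun a => MonoidAlgebra.of k G a • ψ (MonoidAlgebra.of k G a⁻¹ • v)
  have hc : ∀ a, ∀ d ∈ D, c (a * d) = c a := fun a d hd => by
    simp only [c, mul_inv_rev, map_mul, mul_smul]
    rw [hψ _ (inv_mem hd), smul_smul (MonoidAlgebra.of k G d), ← map_mul, mul_inv_cancel, map_one,
      one_smul]
  let c' : G ⧸ D → F := Quotient.lift c fun a b hab => by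
    rw [← hc a _ (QuotientGroup.leftRel_apply.1 hab), mul_inv_cancel_left]
  have hc' : ∀ a : G, c a = c' (a : G ⧸ D) := fun _ => rfl
  have h₁ : ∀ C : G ⧸ D, MonoidAlgebra.of k G C.out •
      ψ (MonoidAlgebra.of k G C.out⁻¹ • MonoidAlgebra.of k G g • v) =
        MonoidAlgebra.of k G g • c' (g⁻¹ • C) := fun C => by
    have : g⁻¹ • C = ((g⁻¹ * C.out : G) : G ⧸ D) := by
      conv_lhs => rw [← QuotientGroup.out_eq' C]
      rfl
    rw [this, ← hc']
    simp only [c, smul_smul, ← map_mul, mul_inv_rev, inv_inv, mul_inv_cancel_left]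
  have h₂ : ∀ C : G ⧸ D, MonoidAlgebra.of k G C.out • ψ (MonoidAlgebra.of k G C.out⁻¹ • v) =
      c' C := fun C => by
    conv_rhs => rw [← QuotientGroup.out_eq' C]
    rfl
  simp only [h₁, h₂, ← Finset.smul_sum]
  congr 1
  exact Equiv.sum_comp (MulAction.toPerm g⁻¹) c'

omit [IsScalarTower k (MonoidAlgebra k G) E] [IsScalarTower k (MonoidAlgebra k G) F] in
theorem map_of_smul_of_generator {D : Subgroup G} {g : D} (hg : ∀ d : D, d ∈ Subgroup.zpowers g)
    (ψ : E →ₗ[k] F) (hψ : ∀ v, ψ (MonoidAlgebra.of k G (g : G) • v) =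
      MonoidAlgebra.of k G (g : G) • ψ v) :
    ∀ d ∈ D, ∀ v, ψ (MonoidAlgebra.of k G d • v) = MonoidAlgebra.of k G d • ψ v := by
  let S : Subgroup G :=
    { carrier := {d | ∀ v, ψ (MonoidAlgebra.of k G d • v) = MonoidAlgebra.of k G d • ψ v}
      one_mem' := fun v => by rw [map_one, one_smul, one_smul]
      mul_mem' := fun {a b} ha hb v => by rw [map_mul, mul_smul, ha, hb, mul_smul]
      inv_mem' := fun {a} ha v => by
        have h := ha (MonoidAlgebra.of k G a⁻¹ • v)
        rw [smul_smul, ← map_mul, mul_inv_cancel, map_one, one_smul] at h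
        rw [h, smul_smul, ← map_mul, inv_mul_cancel, map_one, one_smul] }
  intro d hd
  obtain ⟨j, hj⟩ := hg ⟨d, hd⟩
  have : d = (g : G) ^ j := by simpa using (congr_arg Subtype.val hj).symm
  rw [this]
  exact S.zpow_mem (show (g : G) ∈ S from hψ) j

/-- If a relative trace from a cyclic subgroup acts as the identity on modules of bounded
dimension, each with a nonzero vector killed by all maps to the others, then there are only
finitely many of them. -/
theorem finite_of_separated_family [Finite G] (D : Subgroup G) [IsCyclic D] [Fintype (G ⧸ D)]
    (x : MonoidAlgebra k G)
    (hx : ∀ d ∈ D, MonoidAlgebra.of k G d * x * MonoidAlgebra.of k G d⁻¹ = x)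
    {S : Type*} (E : S → Type*) [∀ s, AddCommGroup (E s)] [∀ s, Module k (E s)]
    [∀ s, Module (MonoidAlgebra k G) (E s)] [∀ s, IsScalarTower k (MonoidAlgebra k G) (E s)]
    [∀ s, FiniteDimensional k (E s)]
    (hE : ∀ s, ∀ v : E s, (∑ C : G ⧸ D, MonoidAlgebra.of k G C.out * x *
      MonoidAlgebra.of k G C.out⁻¹) • v = v)
    (n : ℕ) (hn : ∀ s, Module.finrank k (E s) ≤ n) (v : ∀ s, E s) (hv : ∀ s, v s ≠ 0)
    (hvE : ∀ s t, s ≠ t → ∀ φ : E s →ₗ[MonoidAlgebra k G] E t, φ (v s) = 0) : Finite S := by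
  obtain ⟨g, hg⟩ := IsCyclic.exists_generator (α := D)
  let f : k[X] := X ^ Nat.card G - 1
  have hf : f ≠ 0 := X_pow_sub_C_ne_zero Nat.card_pos 1
  have := TorsionSum.finiteDimensional hf n
  choose i p hi hp hpi using fun s => TorsionSum.exists_retract_of_aeval hf
    (Algebra.lsmul k k (E s) (MonoidAlgebra.of k G (g : G)))
    (by
      rw [map_sub, map_pow, aeval_X, map_one, ← map_pow, ← map_pow, pow_card_eq_one', map_one,
        map_one, sub_self]) (hn s)
  have hcomm : ∀ d ∈ D, MonoidAlgebra.of k G d * x = x * MonoidAlgebra.of k G d := fun d hd => by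
    conv_rhs => rw [← hx d hd]
    rw [mul_assoc _ _ (MonoidAlgebra.of k G d), ← map_mul, inv_mul_cancel, map_one, mul_one]
  let I : ∀ s, E s →ₗ[k] (G ⧸ D → TorsionSum f n) := fun s => LinearMap.pi fun C =>
    i s ∘ₗ Algebra.lsmul k k (E s) (x * MonoidAlgebra.of k G C.out⁻¹)
  let J : ∀ s, (G ⧸ D → TorsionSum f n) →ₗ[k] E s := fun s => ∑ C : G ⧸ D,
    Algebra.lsmul k k (E s) (MonoidAlgebra.of k G C.out) ∘ₗ p s ∘ₗ LinearMap.proj C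
  have hJI : ∀ s t w, J t (I s w) = ∑ C : G ⧸ D,
      MonoidAlgebra.of k G C.out • p t (i s (x • MonoidAlgebra.of k G C.out⁻¹ • w)) := by
    intro s t w
    simp [J, I]
  have hself : ∀ s w, J s (I s w) = w := fun s w => by
    rw [hJI]
    conv_rhs => rw [← hE s w, Finset.sum_smul]
    simp only [hpi, mul_smul]
  have hne : ∀ s t, s ≠ t → J t (I s (v s)) = 0 := fun s t hst => by
    obtain ⟨φ, hφ⟩ := exists_linearMap_eq_relTrace D
      (p t ∘ₗ i s ∘ₗ Algebra.lsmul k k (E s) x)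
      (map_of_smul_of_generator hg _ fun w => by
        have h := hi s (x • w)
        have h' := hp t (i s (x • w))
        simp only [Algebra.lsmul_coe] at h h'
        simp only [LinearMap.comp_apply, Algebra.lsmul_coe]
        rw [smul_smul, ← hcomm _ g.2, mul_smul, h, h'])
    rw [hJI, ← hvE s t hst φ, hφ]
    rfl
  have hind : LinearIndependent k fun s => I s (v s) := by
    rw [linearIndependent_iff']
    intro σ c hc t ht
    have h := congr_arg (J t) hc
    rw [map_sum, map_zero, Finset.sum_eq_single t (fun s _ hs => by
      rw [map_smul, hne s t hs, smul_zero]) (fun h => (h ht).elim), map_smul, hself] at h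
    exact (smul_eq_zero.1 h).resolve_right (hv t)
  exact hind.finite

end RelativeTrace

section CyclicDefect

variable {k G : Type} [Field k] [IsAlgClosed k] [Group G] [Finite G]

/-- The unique simple module of a block with cyclic defect group has a periodic resolution by a
local projective module. -/
theorem exists_periodic_of_isCyclic (D : Subgroup G) [IsCyclic D] [Fintype (G ⧸ D)]
    {x e : MonoidAlgebra k G}
    (hx : ∀ d ∈ D, MonoidAlgebra.of k G d * x * MonoidAlgebra.of k G d⁻¹ = x)
    (hxe : ∑ C : G ⧸ D, MonoidAlgebra.of k G C.out * x * MonoidAlgebra.of k G C.out⁻¹ = e)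
    (he_central : ∀ a, e * a = a * e) (he_idem : e * e = e)
    (V : Type) [AddCommGroup V] [Module k V] [Module (MonoidAlgebra k G) V]
    [IsScalarTower k (MonoidAlgebra k G) V] [IsSimpleModule (MonoidAlgebra k G) V]
    (hVe : ∀ v : V, e • v = v) (hVp : ¬ Module.Projective (MonoidAlgebra k G) V)
    (huniq : ∀ (W : Type) [AddCommGroup W] [Module (MonoidAlgebra k G) W]
      [IsSimpleModule (MonoidAlgebra k G) W], (∀ w : W, e • w = w) →
        Nonempty (W ≃ₗ[MonoidAlgebra k G] V)) :
    ∃ (P : Submodule (MonoidAlgebra k G) (MonoidAlgebra k G)) (π : P →ₗ[MonoidAlgebra k G] V)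
      (a b : P →ₗ[MonoidAlgebra k G] P), Module.Projective (MonoidAlgebra k G) P ∧
      Function.Surjective π ∧ LinearMap.range a = LinearMap.ker π ∧
      LinearMap.range a = LinearMap.ker b ∧ LinearMap.range b = LinearMap.ker a ∧ π ∘ₗ b = 0 ∧
      ∀ f : P →ₗ[MonoidAlgebra k G] V, ∃ c : k, f = c • π := by
  have hA : Module.Finite k (MonoidAlgebra k G) := inferInstance
  have : IsArtinianRing (MonoidAlgebra k G) := .of_finite k _
  have : IsNoetherianRing (MonoidAlgebra k G) := .of_finite k _
  obtain ⟨P, π, hP, hπ, hloc⟩ := exists_projective_cover_of_isSimpleModule (MonoidAlgebra k G) V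
  have hPk : FiniteDimensional k P := Module.Finite.trans (MonoidAlgebra k G) P
  have hVk : FiniteDimensional k V := .of_surjective (π.restrictScalars k) hπ
  have hPe : ∀ p : P, e • p = p := by
    let ε : P →ₗ[MonoidAlgebra k G] P :=
      { toFun := fun p => e • p
        map_add' := smul_add e
        map_smul' := fun a p => by
          rw [RingHom.id_apply, smul_smul, smul_smul, he_central] }
    have hε : LinearMap.range ε = ⊤ := hloc _ fun h => by
      obtain ⟨v, hv⟩ := @exists_ne V (IsSimpleModule.nontrivial (MonoidAlgebra k G) V) 0
      obtain ⟨p, rfl⟩ := hπ v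
      have : π (e • p) = 0 := h ⟨p, rfl⟩
      rw [map_smul, hVe] at this
      exact hv this
    intro p
    obtain ⟨q, rfl⟩ := LinearMap.range_eq_top.1 hε p
    change e • e • q = e • q
    rw [smul_smul, he_idem]
  have hV : ∀ f : V →ₗ[MonoidAlgebra k G] V, ∃ c : k, f = c • LinearMap.id := fun f => by
    obtain ⟨c, hc⟩ := (IsSimpleModule.algebraMap_end_bijective_of_isAlgClosed k
      (A := MonoidAlgebra k G) (V := V)).2 f
    exact ⟨c, by rw [← hc]; rfl⟩
  have hker : LinearMap.ker π ≠ ⊥ := fun h =>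
    hVp (.of_equiv (LinearEquiv.ofBijective π ⟨LinearMap.ker_eq_bot.1 h, hπ⟩))
  have hsimple : ∀ M : Submodule (MonoidAlgebra k G) (LinearMap.ker π), IsCoatom M →
      ∃ b : LinearMap.ker π →ₗ[MonoidAlgebra k G] V, LinearMap.ker b = M := fun M hM => by
    have := isSimpleModule_iff_isCoatom.2 hM
    obtain ⟨Φ⟩ := huniq (LinearMap.ker π ⧸ M) fun w => by
      obtain ⟨w, rfl⟩ := M.mkQ_surjective w
      rw [← map_smul]
      exact congr_arg _ (Subtype.ext (hPe w))
    exact ⟨Φ.toLinearMap ∘ₗ M.mkQ, by rw [LinearEquiv.ker_comp, Submodule.ker_mkQ]⟩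
  obtain ⟨a, b, hab⟩ := exists_periodic_of_local (k := k) hπ hloc hker hsimple fun a b hab => by
    obtain ⟨L, hL⟩ := exists_family_of_linearIndependent hV hπ hloc hab
    choose v hv hvL using hL
    have := finite_of_separated_family D x hx (fun s => P ⧸ L s)
      (fun s w => by
        obtain ⟨w, rfl⟩ := (L s).mkQ_surjective w
        rw [hxe, ← map_smul, hPe])
      (Module.finrank k P)
      (fun s => LinearMap.finrank_le_finrank_of_surjective
        (f := (L s).mkQ.restrictScalars k) (L s).mkQ_surjective) v hv hvL
    exact not_finite k
  exact ⟨P, π, a, b, hP, hπ, hab.1, hab.2.1, hab.2.2.1, hab.2.2.2,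
    exists_smul_eq_of_local hV hπ hloc⟩

end CyclicDefect

section Transfer

variable {k G : Type} [Field k] [Group G]

theorem nonempty_ext_iso_of_periodic_module (V : Rep.{0} k G) [Simple V] {P : Type} [AddCommGroup P]
    [Module (MonoidAlgebra k G) P] [Module.Projective (MonoidAlgebra k G) P]
    {π : P →ₗ[MonoidAlgebra k G] V.ρ.asModule} (hπ : Function.Surjective π)
    {a b : P →ₗ[MonoidAlgebra k G] P} (haπ : LinearMap.range a = LinearMap.ker π)
    (hab : LinearMap.range a = LinearMap.ker b) (hba : LinearMap.range b = LinearMap.ker a)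
    (hbπ : π ∘ₗ b = 0) (hP : ∀ f : P →ₗ[MonoidAlgebra k G] V.ρ.asModule, ∃ c : k, f = c • π)
    (n : ℕ) :
    Nonempty (((Ext k (Rep k G) n).obj (Opposite.op V)).obj V ≅ ModuleCat.of k k) := by
  let F := Rep.ofModuleMonoidAlgebra (k := k) (G := G)
  let P' : ModuleCat (MonoidAlgebra k G) := ModuleCat.of _ P
  let V' : ModuleCat (MonoidAlgebra k G) := Rep.toModuleMonoidAlgebra.obj V
  let a' : P' ⟶ P' := ModuleCat.ofHom a
  let b' : P' ⟶ P' := ModuleCat.ofHom b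
  let π' : P' ⟶ V' := ModuleCat.ofHom π
  have hab' : a' ≫ b' = 0 := ModuleCat.hom_ext (LinearMap.range_le_ker_iff.1 hab.le)
  have hba' : b' ≫ a' = 0 := ModuleCat.hom_ext (LinearMap.range_le_ker_iff.1 hba.le)
  have haπ' : a' ≫ π' = 0 := ModuleCat.hom_ext (LinearMap.range_le_ker_iff.1 haπ.le)
  have hbπ' : b' ≫ π' = 0 := ModuleCat.hom_ext hbπ
  have eab : (ShortComplex.mk a' b' hab').Exact :=
    ((ShortComplex.mk a' b' hab').moduleCat_exact_iff_range_eq_ker).2 hab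
  have eba : (ShortComplex.mk b' a' hba').Exact :=
    ((ShortComplex.mk b' a' hba').moduleCat_exact_iff_range_eq_ker).2 hba
  have eaπ : (ShortComplex.mk a' π' haπ').Exact :=
    ((ShortComplex.mk a' π' haπ').moduleCat_exact_iff_range_eq_ker).2 haπ
  have : Epi π' := (ModuleCat.epi_iff_surjective π').2 hπ
  have : Projective P' := (IsProjective.iff_projective P).1 inferInstance
  have : Projective (F.obj P') :=
    (Rep.equivalenceModuleMonoidAlgebra (k := k) (G := G)).symm.map_projective_iff P' |>.2 this
  let p : F.obj P' ⟶ V := F.map π' ≫ (Rep.unitIso V).inv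
  have hp {f : P' ⟶ P'} (hf : f ≫ π' = 0) : F.map f ≫ p = 0 := by
    rw [← Category.assoc, ← F.map_comp, hf, F.map_zero, Limits.zero_comp]
  refine nonempty_ext_iso_of_periodic (F.map a') (F.map b') p
    (by rw [← F.map_comp, hab', F.map_zero]) (by rw [← F.map_comp, hba', F.map_zero])
    (hp haπ') (hp hbπ') (eab.map F) (eba.map F) ?_ (fun f => ?_) n
  · refine ShortComplex.exact_of_iso (S₁ := (ShortComplex.mk a' π' haπ').map F)
      (ShortComplex.isoMk (Iso.refl _) (Iso.refl _) (Rep.unitIso V).symm ?_ ?_) (eaπ.map F)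
    · exact (Category.id_comp _).trans (Category.comp_id _).symm
    · exact Category.id_comp _
  · obtain ⟨g, hg⟩ := F.map_surjective (f ≫ (Rep.unitIso V).hom)
    obtain ⟨c, hc⟩ := hP g.hom
    have hgc : F.map g = c • F.map π' := by
      ext v
      exact (LinearMap.congr_fun hc v).trans (algebraMap_smul (MonoidAlgebra k G) c (π v)).symm
    exact ⟨c, by rw [← Linear.smul_comp, ← hgc, hg, Category.assoc, Iso.hom_inv_id,
      Category.comp_id]⟩

end Transfer

section Rep

variable {k G : Type} [Field k] [Group G]

theorem Rep.projective_of_module_projective (V : Rep.{0} k G)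
    (h : Module.Projective (MonoidAlgebra k G) V.ρ.asModule) : Projective V := by
  rw [← Rep.equivalenceModuleMonoidAlgebra.map_projective_iff]
  exact (IsProjective.iff_projective V.ρ.asModule).1 h

theorem Rep.isSimpleModule (V : Rep.{0} k G) [Simple V] :
    IsSimpleModule (MonoidAlgebra k G) V.ρ.asModule :=
  (simple_iff_isSimpleModule' _).1 (simple_obj Rep.toModuleMonoidAlgebra V)

theorem nonempty_linearEquiv_of_rep {e : MonoidAlgebra k G} {V : Rep.{0} k G}
    (huniq : ∀ W : Rep.{0} k G, Simple W →
      (∀ w : W, Representation.asAlgebraHom W.ρ e w = w) → Nonempty (W ≅ V))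
    (W : Type) [AddCommGroup W] [Module (MonoidAlgebra k G) W]
    [IsSimpleModule (MonoidAlgebra k G) W] (hW : ∀ w : W, e • w = w) :
    Nonempty (W ≃ₗ[MonoidAlgebra k G] V.ρ.asModule) := by
  let W' : ModuleCat (MonoidAlgebra k G) := ModuleCat.of _ W
  obtain ⟨Φ⟩ := huniq (Rep.ofModuleMonoidAlgebra.obj W') (simple_obj _ _) fun w => by
    refine (Representation.ofModule_asAlgebraHom_apply_apply W e w).trans ?_
    rw [hW]
    exact AddEquiv.symm_apply_apply _ _
  exact ⟨((Rep.counitIso W').symm ≪≫ Rep.toModuleMonoidAlgebra.mapIso Φ).toLinearEquiv⟩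

end Rep

/-- Let `G` be a finite group, `k` an algebraically closed field of
characteristic `r`, and `V` an irreducible `kG`-module that is the unique non-projective
simple module in its block `B` (given by a primitive central idempotent `e` of `kG`),
and suppose the defect group of `B` is cyclic. Then `Ext_G^n(V, V) ≅ k` for all `n ≥ 0`. -/
theorem stmt9 {r : ℕ} [Fact r.Prime] {k G : Type} [Field k] [IsAlgClosed k] [CharP k r]
    [Group G] [Finite G]
    (e : MonoidAlgebra k G)
    (he_central : ∀ a : MonoidAlgebra k G, e * a = a * e)
    (he_idem : e * e = e) (he_ne : e ≠ 0)
    (he_prim : ∀ f₁ f₂ : MonoidAlgebra k G,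
      (∀ a, f₁ * a = a * f₁) → (∀ a, f₂ * a = a * f₂) →
      f₁ * f₁ = f₁ → f₂ * f₂ = f₂ → f₁ * f₂ = 0 → e = f₁ + f₂ → f₁ = 0 ∨ f₂ = 0)
    (V : Rep k G) [Simple V]
    (hVe : ∀ v : V, Representation.asAlgebraHom V.ρ e v = v)
    (hVnotproj : ¬ Projective V)
    (huniq : ∀ W : Rep k G, Simple W →
      (∀ w : W, Representation.asAlgebraHom W.ρ e w = w) → Nonempty (W ≅ V))
    (D : Subgroup G) (hD : IsDefectGroupOf D e) (hcyc : IsCyclic D) :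
    ∀ n : ℕ,
      Nonempty (((Ext k (Rep k G) n).obj (Opposite.op V)).obj V ≅ ModuleCat.of k k) := by
  have := Fintype.ofFinite (G ⧸ D)
  obtain ⟨⟨x, hx, hxe⟩, -⟩ := hD
  have := V.isSimpleModule
  obtain ⟨P, π, a, b, hP, hπ, haπ, hab, hba, hbπ, hend⟩ :=
    exists_periodic_of_isCyclic D hx (by rw [← hxe, conjTrace]; congr!) he_central he_idem
      V.ρ.asModule (fun v => hVe v) (fun h => hVnotproj (V.projective_of_module_projective h))
      (nonempty_linearEquiv_of_rep huniq)
  exact nonempty_ext_iso_of_periodic_module V hπ haπ hab hba hbπ hend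
end
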